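/- arXiv:2401.10885 — 4 statements merged into one kernel-verified Lean document; each statement's English description precedes it below -/
import Mathlib

section
/- Let λ_1,…,λ_n ≥ 0 and let φ_1,…,φ_n : ℝ^d → ℂ be differentiable at a point x ∈ ℝ^d with ρ(x) > 0. Then the intrinsic kinetic energy tensor ω(x) = 𝛕(x) − (ζ(x) ⊗ conj(ζ(x)))/ρ(x) is a Hermitian positive semidefinite d×d complex matrix, i.e. conj(w)ᵀ ω(x) w ≥ 0 for every w ∈ ℂ^d and ω(x)^† = ω(x). -/
open MeasureTheory Complex Finset Matrix ComplexOrder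

/-- Partial derivative of a complex-valued function on `ℝ^d` in the `i`-th
coordinate direction. -/
noncomputable def pderivC {d : ℕ} (f : EuclideanSpace ℝ (Fin d) → ℂ)
    (x : EuclideanSpace ℝ (Fin d)) (i : Fin d) : ℂ :=
  fderiv ℝ f x (EuclideanSpace.single i 1)

/-- The Schur complement identity: subtracting the weighted projection of the vectors `a j` along
the scalars `c j` from their weighted Gram tensor gives the weighted Gram tensor of residuals. -/
theorem sum_smul_vecMulVec_residual {ι κ : Type*} [Fintype ι] (l : ι → ℝ) (a : ι → κ → ℂ)
    (c : ι → ℂ) (ρ : ℝ) (hρ : ρ = ∑ j, l j * ‖c j‖ ^ 2) (hρ0 : ρ ≠ 0)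
    (ζ : κ → ℂ) (hζ : ∀ i, ζ i = ∑ j, (l j : ℂ) * a j i * (starRingEnd ℂ) (c j)) (i k : κ) :
    ∑ j, (l j : ℂ) * a j i * (starRingEnd ℂ) (a j k) - ζ i * (starRingEnd ℂ) (ζ k) / (ρ : ℂ) =
      ∑ j, (l j : ℂ) * ((a j i - ζ i / ρ * c j) *
        (starRingEnd ℂ) (a j k - ζ k / ρ * c j)) := by
  have hρC : (ρ : ℂ) = ∑ j, (l j : ℂ) * (c j * (starRingEnd ℂ) (c j)) := by
    simp [hρ, Complex.mul_conj']
  have hζconj : (starRingEnd ℂ) (ζ k) = ∑ j, (l j : ℂ) * (starRingEnd ℂ) (a j k) * c j := by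
    simp [hζ]
  have hρ0' : (ρ : ℂ) ≠ 0 := by exact_mod_cast hρ0
  have expand : ∀ j, (l j : ℂ) * ((a j i - ζ i / ρ * c j) *
        (starRingEnd ℂ) (a j k - ζ k / ρ * c j)) =
      (l j : ℂ) * a j i * (starRingEnd ℂ) (a j k)
      - (starRingEnd ℂ) (ζ k) / ρ * ((l j : ℂ) * a j i * (starRingEnd ℂ) (c j))
      - ζ i / ρ * ((l j : ℂ) * (starRingEnd ℂ) (a j k) * c j)
      + ζ i / ρ * ((starRingEnd ℂ) (ζ k) / ρ) * ((l j : ℂ) * (c j * (starRingEnd ℂ) (c j))) := by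
    intro j
    simp only [map_sub, map_mul, map_div₀, Complex.conj_ofReal]
    ring
  simp only [expand, Finset.sum_add_distrib, Finset.sum_sub_distrib, ← Finset.mul_sum]
  rw [← hζ, ← hζconj, ← hρC]
  field_simp
  ring

theorem stmt2 {d n : ℕ} (lam : Fin n → ℝ) (hlam : ∀ j, 0 ≤ lam j)
    (φ : Fin n → EuclideanSpace ℝ (Fin d) → ℂ) (x : EuclideanSpace ℝ (Fin d))
    (hφ : ∀ j, DifferentiableAt ℝ (φ j) x)
    -- density ρ(x)
    (ρ : ℝ) (hρ : ρ = ∑ j, lam j * ‖φ j x‖ ^ 2) (hρpos : 0 < ρ)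
    -- complex current density ζ(x) ∈ ℂ^d
    (ζ : Fin d → ℂ)
    (hζ : ζ = fun i => ∑ j, (lam j : ℂ) * pderivC (φ j) x i * (starRingEnd ℂ) (φ j x))
    -- kinetic energy tensor 𝛕(x)
    (τ : Matrix (Fin d) (Fin d) ℂ)
    (hτ : τ = Matrix.of fun i k =>
      ∑ j, (lam j : ℂ) * pderivC (φ j) x i * (starRingEnd ℂ) (pderivC (φ j) x k))
    -- intrinsic kinetic energy tensor ω(x)
    (ω : Matrix (Fin d) (Fin d) ℂ)
    (hω : ω = Matrix.of fun i k => τ i k - ζ i * (starRingEnd ℂ) (ζ k) / (ρ : ℂ)) :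
    ω.PosSemidef := by
  have hω' : ω = ∑ j, (lam j : ℂ) • vecMulVec (fun i => pderivC (φ j) x i - ζ i / ρ * φ j x)
      (star fun i => pderivC (φ j) x i - ζ i / ρ * φ j x) := by
    ext i k
    rw [hω, Matrix.of_apply, hτ, Matrix.of_apply,
      sum_smul_vecMulVec_residual lam (fun j => pderivC (φ j) x) (fun j => φ j x) ρ hρ hρpos.ne' ζ
        (fun i => congrFun hζ i) i k]
    simp [Matrix.sum_apply, vecMulVec_apply]
  rw [hω']
  exact posSemidef_sum _ fun j _ =>
    (posSemidef_vecMulVec_self_star _).smul (by exact_mod_cast hlam j)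
end

section
/- Let λ_1,…,λ_n ≥ 0 and let φ_1,…,φ_n : ℝ^d → ℂ be twice continuously differentiable on a neighborhood of a point x₀ ∈ ℝ^d with ρ(x₀) > 0. Then (ω(x₀) − ω(x₀)ᵀ)/(2i) = ρ(x₀) · D_a(j/ρ)(x₀), where D_a(j/ρ) is the antisymmetric part of the Jacobian of the vector field j/ρ (defined on the open set where ρ > 0). -/
open MeasureTheory Complex Finset Matrix

/-- Partial derivative of a real-valued function on `ℝ^d` in the `i`-th
coordinate direction. -/
noncomputable def pderivR {d : ℕ} (f : EuclideanSpace ℝ (Fin d) → ℝ)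
    (x : EuclideanSpace ℝ (Fin d)) (i : Fin d) : ℝ :=
  fderiv ℝ f x (EuclideanSpace.single i 1)

theorem ContDiffAt.hasFDerivAt_pderivC {d : ℕ} {f : EuclideanSpace ℝ (Fin d) → ℂ}
    {x : EuclideanSpace ℝ (Fin d)} (hf : ContDiffAt ℝ 2 f x) (i : Fin d) :
    HasFDerivAt (fun y => pderivC f y i)
      ((fderiv ℝ (fderiv ℝ f) x).flip (EuclideanSpace.single i 1)) x := by
  have h : DifferentiableAt ℝ (fderiv ℝ f) x :=
    (hf.fderiv_right (m := 1) (by norm_num)).differentiableAt (by norm_num)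
  exact ((ContinuousLinearMap.apply ℝ ℂ (EuclideanSpace.single i (1 : ℝ))).hasFDerivAt.comp x
    h.hasFDerivAt).congr_fderiv (by ext; simp)

theorem pderivR_div {d : ℕ} {f g : EuclideanSpace ℝ (Fin d) → ℝ}
    {f' g' : EuclideanSpace ℝ (Fin d) →L[ℝ] ℝ} {x : EuclideanSpace ℝ (Fin d)}
    (hf : HasFDerivAt f f' x) (hg : HasFDerivAt g g' x) (hx : g x ≠ 0) (k : Fin d) :
    pderivR (fun y => f y / g y) x k =
      (f' (EuclideanSpace.single k 1) * g x - f x * g' (EuclideanSpace.single k 1)) / g x ^ 2 := by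
  have h : HasFDerivAt (fun y => f y / g y) _ x :=
    hf.mul ((hasDerivAt_inv hx).comp_hasFDerivAt x hg)
  rw [pderivR, h.fderiv]
  simp
  field_simp
  ring

theorem hasFDerivAt_sum_mul_norm_sq {E ι : Type*} [NormedAddCommGroup E] [NormedSpace ℝ E]
    [Fintype ι] (lam : ι → ℝ) {φ : ι → E → ℂ} {x : E}
    (hφ : ∀ j, DifferentiableAt ℝ (φ j) x) :
    ∃ ρ' : E →L[ℝ] ℝ, HasFDerivAt (fun y => ∑ j, lam j * ‖φ j y‖ ^ 2) ρ' x ∧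
      ∀ v, ρ' v = 2 * (∑ j, (lam j : ℂ) * fderiv ℝ (φ j) x v * (starRingEnd ℂ) (φ j x)).re := by
  refine ⟨_, HasFDerivAt.fun_sum fun j _ => ((hφ j).hasFDerivAt.norm_sq.const_mul (lam j)), ?_⟩
  intro v
  simp only [_root_.sum_apply, Complex.re_sum, Finset.mul_sum]
  refine Finset.sum_congr rfl fun j _ => ?_
  simp [Complex.inner]
  ring

theorem hasFDerivAt_im_sum_pderivC_mul_conj {d : ℕ} {ι : Type*} [Fintype ι] (lam : ι → ℝ)
    {φ : ι → EuclideanSpace ℝ (Fin d) → ℂ} {x : EuclideanSpace ℝ (Fin d)}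
    (hφ : ∀ j, ContDiffAt ℝ 2 (φ j) x) (i : Fin d) :
    ∃ j' : EuclideanSpace ℝ (Fin d) →L[ℝ] ℝ,
      HasFDerivAt
        (fun y => (∑ j, (lam j : ℂ) * pderivC (φ j) y i * (starRingEnd ℂ) (φ j y)).im) j' x ∧
      ∀ v, j' v = (∑ j, (lam j : ℂ) * (pderivC (φ j) x i * (starRingEnd ℂ) (fderiv ℝ (φ j) x v) +
        fderiv ℝ (fderiv ℝ (φ j)) x v (EuclideanSpace.single i 1) *
          (starRingEnd ℂ) (φ j x))).im := by
  have hsum := HasFDerivAt.fun_sum (u := Finset.univ) fun j _ =>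
    (((hφ j).hasFDerivAt_pderivC i).const_mul (lam j : ℂ)).mul
      ((hφ j).differentiableAt (by norm_num)).hasFDerivAt.star
  refine ⟨_, Complex.imCLM.hasFDerivAt.comp x hsum, ?_⟩
  intro v
  simp only [ContinuousLinearMap.comp_apply, _root_.sum_apply, Complex.imCLM_apply]
  congr 1
  refine Finset.sum_congr rfl fun j _ => ?_
  simp
  ring

theorem stmt3 {d n : ℕ} (lam : Fin n → ℝ) (hlam : ∀ j, 0 ≤ lam j)
    (φ : Fin n → EuclideanSpace ℝ (Fin d) → ℂ) (x₀ : EuclideanSpace ℝ (Fin d))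
    (hφ : ∀ j, ContDiffAt ℝ 2 (φ j) x₀)
    -- density ρ
    (ρ : EuclideanSpace ℝ (Fin d) → ℝ) (hρ : ρ = fun x => ∑ j, lam j * ‖φ j x‖ ^ 2)
    (hρpos : 0 < ρ x₀)
    -- complex current density ζ
    (ζ : EuclideanSpace ℝ (Fin d) → Fin d → ℂ)
    (hζ : ζ = fun x i => ∑ j, (lam j : ℂ) * pderivC (φ j) x i * (starRingEnd ℂ) (φ j x))
    -- paramagnetic current density j
    (jp : EuclideanSpace ℝ (Fin d) → Fin d → ℝ) (hjp : jp = fun x i => (ζ x i).im)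
    -- kinetic energy tensor 𝛕(x₀)
    (τ : Matrix (Fin d) (Fin d) ℂ)
    (hτ : τ = Matrix.of fun i k =>
      ∑ j, (lam j : ℂ) * pderivC (φ j) x₀ i * (starRingEnd ℂ) (pderivC (φ j) x₀ k))
    -- intrinsic kinetic energy tensor ω(x₀)
    (ω : Matrix (Fin d) (Fin d) ℂ)
    (hω : ω = Matrix.of fun i k => τ i k - ζ x₀ i * (starRingEnd ℂ) (ζ x₀ k) / (ρ x₀ : ℂ))
    -- Jacobian matrix of the vector field j/ρ at x₀, (Du)_{ik} = ∂_k (j_i/ρ)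
    (Du : Matrix (Fin d) (Fin d) ℝ)
    (hDu : Du = Matrix.of fun i k => pderivR (fun x => jp x i / ρ x) x₀ k)
    -- antisymmetric part of the Jacobian
    (Da : Matrix (Fin d) (Fin d) ℝ) (hDa : Da = (Du - Duᵀ) / 2) :
    ∀ i k, (ω i k - ωᵀ i k) / (2 * Complex.I) = ((ρ x₀ * Da i k : ℝ) : ℂ) := by
  have hφd : ∀ j, DifferentiableAt ℝ (φ j) x₀ := fun j => (hφ j).differentiableAt (by norm_num)
  obtain ⟨ρ', hρ', hρ'v⟩ := hasFDerivAt_sum_mul_norm_sq lam hφd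
  rw [← hρ] at hρ'
  choose j' hj' hj'v using hasFDerivAt_im_sum_pderivC_mul_conj lam hφ
  have hζv : ∀ i, ρ' (EuclideanSpace.single i 1) = 2 * (ζ x₀ i).re := by
    intro i
    rw [hρ'v, hζ]
    rfl
  have hjp' : ∀ i, HasFDerivAt (fun y => jp y i) (j' i) x₀ := by
    intro i
    simpa only [hjp, hζ] using hj' i
  have hDuv : ∀ i k, Du i k = (j' i (EuclideanSpace.single k 1) * ρ x₀ -
      (ζ x₀ i).im * (2 * (ζ x₀ k).re)) / ρ x₀ ^ 2 := by
    intro i k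
    rw [hDu, Matrix.of_apply, pderivR_div (hjp' i) hρ' hρpos.ne', hζv, hjp]
  have hcurl : ∀ i k, j' i (EuclideanSpace.single k 1) - j' k (EuclideanSpace.single i 1) =
      (τ i k - τ k i).im := by
    intro i k
    rw [hj'v, hj'v, hτ, ← Complex.sub_im, Matrix.of_apply, Matrix.of_apply,
      ← Finset.sum_sub_distrib, ← Finset.sum_sub_distrib]
    congr 1
    refine Finset.sum_congr rfl fun j _ => ?_
    have hsymm := ((hφ j).isSymmSndFDerivAt (by simp)).eq
      (EuclideanSpace.single k 1) (EuclideanSpace.single i 1)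
    rw [hsymm]
    simp only [pderivC]
    ring
  have hτconj : ∀ i k, τ k i = (starRingEnd ℂ) (τ i k) := by
    intro i k
    simp only [hτ, Matrix.of_apply, map_sum, map_mul, Complex.conj_ofReal, Complex.conj_conj]
    exact Finset.sum_congr rfl fun j _ => by ring
  have hhalf : ∀ i k, Da i k = (Du i k - Du k i) / 2 := by
    intro i k
    have hinv : (2 : Matrix (Fin d) (Fin d) ℝ)⁻¹ = (2⁻¹ : ℝ) • 1 := by
      apply Matrix.inv_eq_right_inv
      rw [← one_add_one_eq_two, Matrix.mul_smul, mul_one, ← two_smul ℝ (1 : Matrix _ _ ℝ), smul_smul]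
      norm_num
    rw [hDa, div_eq_mul_inv, hinv]
    simp
    ring
  intro i k
  have hρ0 : ρ x₀ ≠ 0 := hρpos.ne'
  have hc := hcurl i k
  rw [hτconj i k] at hc
  have hω' : ω k i = (starRingEnd ℂ) (ω i k) := by
    simp [hω, hτconj i k, mul_comm]
  have hωim : (ω i k).im = ρ x₀ * Da i k := by
    rw [hhalf, hDuv, hDuv, hω, Matrix.of_apply, Complex.sub_im, Complex.div_ofReal_im]
    simp at hc ⊢
    field_simp
    linear_combination (-ρ x₀) * hc
  rw [Matrix.transpose_apply, hω', Complex.sub_conj, hωim]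
  field_simp
  push_cast
  ring
end

section
/- Let λ_1,…,λ_n ≥ 0 and let φ_1,…,φ_n : ℝ³ → ℂ be smooth with compact support. Then Σ_j λ_j ∫_{ℝ³} |∇φ_j|² ≥ ∫_{{ρ>0}} |∇ρ|²/(4ρ) + ∫_{{ρ>0}} |j|²/ρ + (1/√6) ∫_{{ρ>0}} ρ |curl(j/ρ)|, where the vector field j/ρ and its curl are defined on the open set {ρ > 0}. -/
open MeasureTheory Complex Finset

/-- Partial derivative of a complex-valued function on `ℝ³` in the `i`-th
coordinate direction. -/
noncomputable def pderivC3 (f : EuclideanSpace ℝ (Fin 3) → ℂ)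
    (x : EuclideanSpace ℝ (Fin 3)) (i : Fin 3) : ℂ :=
  fderiv ℝ f x (EuclideanSpace.single i 1)

/-- Partial derivative of a real-valued function on `ℝ³` in the `i`-th
coordinate direction. -/
noncomputable def pderivR3 (f : EuclideanSpace ℝ (Fin 3) → ℝ)
    (x : EuclideanSpace ℝ (Fin 3)) (i : Fin 3) : ℝ :=
  fderiv ℝ f x (EuclideanSpace.single i 1)

/-- The part of `u` orthogonal to `Φ` has inner products `⟪u, v⟫ - ⟪u, Φ⟫ ⟪Φ, v⟫ / ‖Φ‖²`. -/
lemma inner_sub_proj {F : Type*} [NormedAddCommGroup F] [InnerProductSpace ℂ F]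
    {Φ : F} (hΦ : Φ ≠ 0) (u v : F) :
    inner ℂ (u - (inner ℂ Φ u / (‖Φ‖ : ℂ) ^ 2) • Φ) (v - (inner ℂ Φ v / (‖Φ‖ : ℂ) ^ 2) • Φ)
      = inner ℂ u v - inner ℂ u Φ * inner ℂ Φ v / (‖Φ‖ : ℂ) ^ 2 := by
  have h : (‖Φ‖ : ℂ) ≠ 0 := by simpa using hΦ
  simp only [inner_sub_left, inner_sub_right, inner_smul_left, inner_smul_right, map_div₀,
    map_pow, Complex.conj_ofReal, inner_conj_symm]
  rw [inner_self_eq_norm_sq_to_K (𝕜 := ℂ) Φ]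
  simp only [Complex.coe_algebraMap]
  field_simp
  ring

lemma norm_sq_sub_proj {F : Type*} [NormedAddCommGroup F] [InnerProductSpace ℂ F]
    {Φ : F} (hΦ : Φ ≠ 0) (u : F) :
    ‖u - (inner ℂ Φ u / (‖Φ‖ : ℂ) ^ 2) • Φ‖ ^ 2
      = ‖u‖ ^ 2 - ((inner ℂ Φ u).re ^ 2 + (inner ℂ Φ u).im ^ 2) / ‖Φ‖ ^ 2 := by
  have h := inner_sub_proj hΦ u u
  rw [← inner_conj_symm u Φ, inner_self_eq_norm_sq_to_K (𝕜 := ℂ),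
    inner_self_eq_norm_sq_to_K (𝕜 := ℂ), mul_comm ((starRingEnd ℂ) _), Complex.mul_conj,
    Complex.normSq_apply] at h
  simp only [Complex.coe_algebraMap] at h
  have h' : ((‖u - (inner ℂ Φ u / (‖Φ‖ : ℂ) ^ 2) • Φ‖ ^ 2 : ℝ) : ℂ)
      = ((‖u‖ ^ 2 - ((inner ℂ Φ u).re * (inner ℂ Φ u).re
        + (inner ℂ Φ u).im * (inner ℂ Φ u).im) / ‖Φ‖ ^ 2 : ℝ) : ℂ) := by
    push_cast at h ⊢
    exact h
  rw [Complex.ofReal_inj.mp h']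
  ring

lemma im_inner_sq_le {F : Type*} [NormedAddCommGroup F] [InnerProductSpace ℂ F] (u v : F) :
    (inner ℂ u v).im ^ 2 ≤ ‖u‖ ^ 2 * ‖v‖ ^ 2 := by
  rw [← mul_pow, ← sq_abs]
  exact pow_le_pow_left₀ (abs_nonneg _)
    ((Complex.abs_im_le_norm _).trans (norm_inner_le_norm u v)) 2

lemma sqrt_im_inner_le {F : Type*} [NormedAddCommGroup F] [InnerProductSpace ℂ F]
    (u v w : F) :
    1 / Real.sqrt 6 * Real.sqrt ((2 * (inner ℂ v w).im) ^ 2 + (2 * (inner ℂ w u).im) ^ 2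
        + (2 * (inner ℂ u v).im) ^ 2)
      ≤ ‖u‖ ^ 2 + ‖v‖ ^ 2 + ‖w‖ ^ 2 := by
  have h1 := im_inner_sq_le v w
  have h2 := im_inner_sq_le w u
  have h3 := im_inner_sq_le u v
  rw [one_div_mul_eq_div, ← Real.sqrt_div' _ (by norm_num : (0 : ℝ) ≤ 6)]
  apply Real.sqrt_le_iff.mpr
  refine ⟨by positivity, ?_⟩
  have := sq_nonneg ‖u‖
  have := sq_nonneg ‖v‖
  have := sq_nonneg ‖w‖
  generalize ‖u‖ ^ 2 = a at *
  generalize ‖v‖ ^ 2 = b at *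
  generalize ‖w‖ ^ 2 = c at *
  nlinarith [mul_nonneg ‹0 ≤ a› ‹0 ≤ b›, mul_nonneg ‹0 ≤ b› ‹0 ≤ c›,
    mul_nonneg ‹0 ≤ a› ‹0 ≤ c›, sq_nonneg a, sq_nonneg b, sq_nonneg c]

lemma two_mul_im_inner_sub_proj {F : Type*} [NormedAddCommGroup F] [InnerProductSpace ℂ F]
    {Φ : F} (hΦ : Φ ≠ 0) (u v : F) :
    2 * (inner ℂ (u - (inner ℂ Φ u / (‖Φ‖ : ℂ) ^ 2) • Φ)
        (v - (inner ℂ Φ v / (‖Φ‖ : ℂ) ^ 2) • Φ)).im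
      = 2 * (inner ℂ u v).im - 2 * ((inner ℂ Φ u).re * (inner ℂ Φ v).im
          - (inner ℂ Φ u).im * (inner ℂ Φ v).re) / ‖Φ‖ ^ 2 := by
  rw [inner_sub_proj hΦ, ← inner_conj_symm u Φ, ← Complex.ofReal_pow, Complex.sub_im,
    Complex.div_ofReal_im]
  simp only [Complex.mul_im, Complex.conj_re, Complex.conj_im]
  ring

lemma pderivR3_norm_sq {F : Type*} [NormedAddCommGroup F] [InnerProductSpace ℂ F]
    {Φ : EuclideanSpace ℝ (Fin 3) → F} (x : EuclideanSpace ℝ (Fin 3))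
    (hΦ : DifferentiableAt ℝ Φ x) (i : Fin 3) :
    pderivR3 (fun y => ‖Φ y‖ ^ 2) x i
      = 2 * (inner ℂ (Φ x) (fderiv ℝ Φ x (EuclideanSpace.single i 1))).re := by
  let _ : InnerProductSpace ℝ F := InnerProductSpace.rclikeToReal ℂ F
  unfold pderivR3
  rw [(hΦ.hasFDerivAt.norm_sq).fderiv]
  simp [real_inner_eq_re_inner ℂ]

/-- The curl component `∂ₐ (j_b / ρ) - ∂_b (j_a / ρ)` of `ρ = ‖Φ‖²`, `j = Im ⟪Φ, ∇Φ⟫`: the second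
derivatives of `Φ` cancel. -/
lemma pderivR3_current_div_sub {F : Type*} [NormedAddCommGroup F] [InnerProductSpace ℂ F]
    {Φ : EuclideanSpace ℝ (Fin 3) → F} (hΦ : ContDiff ℝ (⊤ : ℕ∞) Φ)
    (x : EuclideanSpace ℝ (Fin 3)) (hx : Φ x ≠ 0) (a b : Fin 3) (A : Fin 3 → F)
    (hA : A = fun i => fderiv ℝ Φ x (EuclideanSpace.single i 1)) :
    ‖Φ x‖ ^ 2 *
      (pderivR3 (fun y => (inner ℂ (Φ y) (fderiv ℝ Φ y (EuclideanSpace.single b 1))).im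
          / ‖Φ y‖ ^ 2) x a
        - pderivR3 (fun y => (inner ℂ (Φ y) (fderiv ℝ Φ y (EuclideanSpace.single a 1))).im
          / ‖Φ y‖ ^ 2) x b)
      = 2 * (inner ℂ (A a) (A b)).im - 2 * ((inner ℂ (Φ x) (A a)).re * (inner ℂ (Φ x) (A b)).im
          - (inner ℂ (Φ x) (A a)).im * (inner ℂ (Φ x) (A b)).re) / ‖Φ x‖ ^ 2 := by
  have hd : DifferentiableAt ℝ Φ x := hΦ.differentiable (by simp) x
  have hd2 : DifferentiableAt ℝ (fderiv ℝ Φ) x :=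
    (hΦ.fderiv_right (m := 1) (by norm_cast)).differentiable (by simp) x
  have hsymm : ∀ v w, fderiv ℝ (fderiv ℝ Φ) x v w = fderiv ℝ (fderiv ℝ Φ) x w v :=
    fun v w => (hΦ.contDiffAt.isSymmSndFDerivAt (by simp; norm_cast)) v w
  let _ : InnerProductSpace ℝ F := InnerProductSpace.rclikeToReal ℂ F
  have hn : DifferentiableAt ℝ (fun y => ‖Φ y‖ ^ 2) x := hd.norm_sq ℝ
  have hn0 : ‖Φ x‖ ^ 2 ≠ 0 := by simpa using hx
  have key : ∀ a b : Fin 3,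
      pderivR3 (fun y => (inner ℂ (Φ y) (fderiv ℝ Φ y (EuclideanSpace.single b 1))).im
          / ‖Φ y‖ ^ 2) x a
      = (((inner ℂ (Φ x) (fderiv ℝ (fderiv ℝ Φ) x (EuclideanSpace.single a 1)
            (EuclideanSpace.single b 1))).im + (inner ℂ (A a) (A b)).im) * ‖Φ x‖ ^ 2
          - (inner ℂ (Φ x) (A b)).im * (2 * (inner ℂ (Φ x) (A a)).re)) / (‖Φ x‖ ^ 2) ^ 2 := by
    intro a b
    have hg : DifferentiableAt ℝ (fun y => fderiv ℝ Φ y (EuclideanSpace.single b 1)) x :=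
      hd2.clm_apply (differentiableAt_const _)
    have hi : DifferentiableAt ℝ
        (fun y => inner ℂ (Φ y) (fderiv ℝ Φ y (EuclideanSpace.single b 1))) x :=
      hd.inner ℂ hg
    have him := Complex.imCLM.hasFDerivAt.comp x hi.hasFDerivAt
    have hdiv := him.mul ((hasDerivAt_inv hn0).comp_hasFDerivAt x hn.hasFDerivAt)
    have hN := pderivR3_norm_sq x hd a
    unfold pderivR3 at hN ⊢
    refine (congrArg (fun L => L (EuclideanSpace.single a 1)) hdiv.fderiv).trans ?_
    have hin := fderiv_inner_apply ℂ hd hg (EuclideanSpace.single a 1)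
    have hgd : fderiv ℝ (fun y => fderiv ℝ Φ y (EuclideanSpace.single b 1)) x
        (EuclideanSpace.single a 1) = fderiv ℝ (fderiv ℝ Φ) x (EuclideanSpace.single a 1)
            (EuclideanSpace.single b 1) := by
      rw [fderiv_clm_apply hd2 (differentiableAt_const _)]
      simp
    rw [hgd] at hin
    have hn1 : ‖Φ x‖ ≠ 0 := by simpa using hx
    simp [hin, hN, hA]
    field_simp
    ring
  rw [key a b, key b a, hsymm (EuclideanSpace.single b 1) (EuclideanSpace.single a 1),
    ← inner_conj_symm (A b) (A a), Complex.conj_im]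
  field_simp
  ring

lemma kinetic_energy_density_ge {F : Type*} [NormedAddCommGroup F] [InnerProductSpace ℂ F]
    {Φ : EuclideanSpace ℝ (Fin 3) → F} (hΦ : ContDiff ℝ (⊤ : ℕ∞) Φ)
    (x : EuclideanSpace ℝ (Fin 3)) (hx : Φ x ≠ 0)
    (ρ : EuclideanSpace ℝ (Fin 3) → ℝ) (hρ : ρ = fun y => ‖Φ y‖ ^ 2)
    (jp : EuclideanSpace ℝ (Fin 3) → Fin 3 → ℝ)
    (hjp : jp = fun y i => (inner ℂ (Φ y) (fderiv ℝ Φ y (EuclideanSpace.single i 1))).im)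
    (curl : Fin 3 → ℝ)
    (hcurl : curl =
      ![pderivR3 (fun y => jp y 2 / ρ y) x 1 - pderivR3 (fun y => jp y 1 / ρ y) x 2,
        pderivR3 (fun y => jp y 0 / ρ y) x 2 - pderivR3 (fun y => jp y 2 / ρ y) x 0,
        pderivR3 (fun y => jp y 1 / ρ y) x 0 - pderivR3 (fun y => jp y 0 / ρ y) x 1]) :
    (∑ i, pderivR3 ρ x i ^ 2) / (4 * ρ x) + (∑ i, jp x i ^ 2) / ρ x
      + 1 / Real.sqrt 6 * (ρ x * Real.sqrt (∑ i, curl i ^ 2))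
      ≤ ∑ i, ‖fderiv ℝ Φ x (EuclideanSpace.single i 1)‖ ^ 2 := by
  have hd : DifferentiableAt ℝ Φ x := hΦ.differentiable (by simp) x
  have hn0 : ‖Φ x‖ ^ 2 ≠ 0 := by simpa using hx
  obtain ⟨A, hA⟩ : ∃ A : Fin 3 → F, A = fun i => fderiv ℝ Φ x (EuclideanSpace.single i 1) :=
    ⟨_, rfl⟩
  have hAi : ∀ i, fderiv ℝ Φ x (EuclideanSpace.single i 1) = A i := fun i => by rw [hA]
  have hcomp := fun a b => (pderivR3_current_div_sub hΦ x hx a b A hA).trans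
    (two_mul_im_inner_sub_proj hx (A a) (A b)).symm
  have hpull : ρ x * Real.sqrt (∑ i, curl i ^ 2)
      = Real.sqrt ((ρ x * curl 0) ^ 2 + (ρ x * curl 1) ^ 2 + (ρ x * curl 2) ^ 2) := by
    have h0 : 0 ≤ ρ x := by rw [hρ]; positivity
    rw [Fin.sum_univ_three, ← Real.sqrt_sq h0, ← Real.sqrt_mul (sq_nonneg _), Real.sqrt_sq h0]
    ring_nf
  rw [hpull]
  subst hρ hjp hcurl
  simp only [Matrix.cons_val_zero, Matrix.cons_val_one, Matrix.cons_val]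
  rw [hcomp, hcomp, hcomp]
  have hmain := sqrt_im_inner_le
    (A 0 - (inner ℂ (Φ x) (A 0) / (‖Φ x‖ : ℂ) ^ 2) • Φ x)
    (A 1 - (inner ℂ (Φ x) (A 1) / (‖Φ x‖ : ℂ) ^ 2) • Φ x)
    (A 2 - (inner ℂ (Φ x) (A 2) / (‖Φ x‖ : ℂ) ^ 2) • Φ x)
  rw [norm_sq_sub_proj hx, norm_sq_sub_proj hx, norm_sq_sub_proj hx] at hmain
  have heq : (∑ i, pderivR3 (fun y => ‖Φ y‖ ^ 2) x i ^ 2) / (4 * ‖Φ x‖ ^ 2)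
      + (∑ i, (inner ℂ (Φ x) (fderiv ℝ Φ x (EuclideanSpace.single i 1))).im ^ 2) / ‖Φ x‖ ^ 2
      = ((inner ℂ (Φ x) (A 0)).re ^ 2 + (inner ℂ (Φ x) (A 0)).im ^ 2) / ‖Φ x‖ ^ 2
      + ((inner ℂ (Φ x) (A 1)).re ^ 2 + (inner ℂ (Φ x) (A 1)).im ^ 2) / ‖Φ x‖ ^ 2
      + ((inner ℂ (Φ x) (A 2)).re ^ 2 + (inner ℂ (Φ x) (A 2)).im ^ 2) / ‖Φ x‖ ^ 2 := by
    simp only [pderivR3_norm_sq x hd, hAi, Fin.sum_univ_three]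
    field_simp
    ring
  rw [heq]
  simp only [hAi, Fin.sum_univ_three]
  linarith

/-- The orbitals with square roots of the weights absorbed, as one vector-valued function. -/
noncomputable def weightedOrbitals {n : ℕ} (lam : Fin n → ℝ)
    (φ : Fin n → EuclideanSpace ℝ (Fin 3) → ℂ) (x : EuclideanSpace ℝ (Fin 3)) :
    EuclideanSpace ℂ (Fin n) :=
  WithLp.toLp 2 fun j => (Real.sqrt (lam j) : ℂ) * φ j x

lemma contDiff_weightedOrbitals {n : ℕ} (lam : Fin n → ℝ)
    {φ : Fin n → EuclideanSpace ℝ (Fin 3) → ℂ} (hφ : ∀ j, ContDiff ℝ (⊤ : ℕ∞) (φ j)) :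
    ContDiff ℝ (⊤ : ℕ∞) (weightedOrbitals lam φ) := by
  rw [contDiff_piLp]
  exact fun j => contDiff_const.mul (hφ j)

lemma fderiv_weightedOrbitals_apply {n : ℕ} (lam : Fin n → ℝ)
    {φ : Fin n → EuclideanSpace ℝ (Fin 3) → ℂ} (hφ : ∀ j, ContDiff ℝ (⊤ : ℕ∞) (φ j))
    (x : EuclideanSpace ℝ (Fin 3)) (i : Fin 3) (j : Fin n) :
    fderiv ℝ (weightedOrbitals lam φ) x (EuclideanSpace.single i 1) j
      = (Real.sqrt (lam j) : ℂ) * pderivC3 (φ j) x i := by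
  have hd : DifferentiableAt ℝ (weightedOrbitals lam φ) x :=
    (contDiff_weightedOrbitals lam hφ).differentiable (by simp) x
  have h1 := (PiLp.hasFDerivAt_apply (𝕜 := ℝ) 2 (weightedOrbitals lam φ x) j).comp x hd.hasFDerivAt
  have h2 := (((hφ j).differentiable (by simp) x).hasFDerivAt).const_mul
    (Real.sqrt (lam j) : ℂ)
  exact congrArg (fun L => L (EuclideanSpace.single i 1)) (h1.unique h2)

lemma norm_sq_weightedOrbitals {n : ℕ} {lam : Fin n → ℝ} (hlam : ∀ j, 0 ≤ lam j)
    (φ : Fin n → EuclideanSpace ℝ (Fin 3) → ℂ) (x : EuclideanSpace ℝ (Fin 3)) :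
    ‖weightedOrbitals lam φ x‖ ^ 2 = ∑ j, lam j * ‖φ j x‖ ^ 2 := by
  rw [EuclideanSpace.norm_sq_eq]
  refine Finset.sum_congr rfl fun j _ => ?_
  simp [weightedOrbitals, mul_pow, Real.sq_sqrt (hlam j)]

lemma norm_sq_fderiv_weightedOrbitals {n : ℕ} {lam : Fin n → ℝ} (hlam : ∀ j, 0 ≤ lam j)
    {φ : Fin n → EuclideanSpace ℝ (Fin 3) → ℂ} (hφ : ∀ j, ContDiff ℝ (⊤ : ℕ∞) (φ j))
    (x : EuclideanSpace ℝ (Fin 3)) (i : Fin 3) :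
    ‖fderiv ℝ (weightedOrbitals lam φ) x (EuclideanSpace.single i 1)‖ ^ 2
      = ∑ j, lam j * ‖pderivC3 (φ j) x i‖ ^ 2 := by
  rw [EuclideanSpace.norm_sq_eq]
  refine Finset.sum_congr rfl fun j _ => ?_
  simp [fderiv_weightedOrbitals_apply lam hφ, mul_pow, Real.sq_sqrt (hlam j)]

lemma inner_weightedOrbitals_fderiv {n : ℕ} {lam : Fin n → ℝ} (hlam : ∀ j, 0 ≤ lam j)
    {φ : Fin n → EuclideanSpace ℝ (Fin 3) → ℂ} (hφ : ∀ j, ContDiff ℝ (⊤ : ℕ∞) (φ j))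
    (x : EuclideanSpace ℝ (Fin 3)) (i : Fin 3) :
    inner ℂ (weightedOrbitals lam φ x)
        (fderiv ℝ (weightedOrbitals lam φ) x (EuclideanSpace.single i 1))
      = ∑ j, (lam j : ℂ) * pderivC3 (φ j) x i * (starRingEnd ℂ) (φ j x) := by
  rw [PiLp.inner_apply]
  refine Finset.sum_congr rfl fun j _ => ?_
  have hs : (lam j : ℂ) = (Real.sqrt (lam j) : ℂ) * (Real.sqrt (lam j) : ℂ) := by
    rw [← Complex.ofReal_mul, Real.mul_self_sqrt (hlam j)]
  rw [fderiv_weightedOrbitals_apply lam hφ, hs]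
  simp [weightedOrbitals, RCLike.inner_apply]
  ring

lemma integrable_sum_norm_sq_pderivC3 {f : EuclideanSpace ℝ (Fin 3) → ℂ}
    (hf : ContDiff ℝ (⊤ : ℕ∞) f) (hs : HasCompactSupport f) :
    Integrable fun x => ∑ i, ‖pderivC3 f x i‖ ^ 2 := by
  refine integrable_finsetSum _ fun i _ => ?_
  have hc : Continuous fun x => pderivC3 f x i :=
    (hf.continuous_fderiv (by simp)).clm_apply continuous_const
  have hsi : HasCompactSupport fun x => pderivC3 f x i :=
    hs.fderiv_apply (𝕜 := ℝ) (EuclideanSpace.single i 1)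
  have hsq : HasCompactSupport fun x => ‖pderivC3 f x i‖ ^ 2 :=
    hsi.comp_left (g := fun z : ℂ => ‖z‖ ^ 2) (by simp)
  exact (hc.norm.pow 2).integrable_of_hasCompactSupport hsq

theorem stmt6 {n : ℕ} (lam : Fin n → ℝ) (hlam : ∀ j, 0 ≤ lam j)
    (φ : Fin n → EuclideanSpace ℝ (Fin 3) → ℂ)
    (hφ : ∀ j, ContDiff ℝ (⊤ : ℕ∞) (φ j)) (hsupp : ∀ j, HasCompactSupport (φ j))
    -- density ρ
    (ρ : EuclideanSpace ℝ (Fin 3) → ℝ) (hρ : ρ = fun x => ∑ j, lam j * ‖φ j x‖ ^ 2)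
    -- paramagnetic current density j
    (jp : EuclideanSpace ℝ (Fin 3) → Fin 3 → ℝ)
    (hjp : jp = fun x i =>
      (∑ j, (lam j : ℂ) * pderivC3 (φ j) x i * (starRingEnd ℂ) (φ j x)).im)
    -- curl of the vector field j/ρ (defined on the open set {ρ > 0})
    (curl : EuclideanSpace ℝ (Fin 3) → Fin 3 → ℝ)
    (hcurl : curl = fun x =>
      ![pderivR3 (fun y => jp y 2 / ρ y) x 1 - pderivR3 (fun y => jp y 1 / ρ y) x 2,
        pderivR3 (fun y => jp y 0 / ρ y) x 2 - pderivR3 (fun y => jp y 2 / ρ y) x 0,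
        pderivR3 (fun y => jp y 1 / ρ y) x 0 - pderivR3 (fun y => jp y 0 / ρ y) x 1]) :
    (∫⁻ x in {x | 0 < ρ x}, ENNReal.ofReal ((∑ i, pderivR3 ρ x i ^ 2) / (4 * ρ x)))
      + (∫⁻ x in {x | 0 < ρ x}, ENNReal.ofReal ((∑ i, jp x i ^ 2) / ρ x))
      + ENNReal.ofReal (1 / Real.sqrt 6) *
          (∫⁻ x in {x | 0 < ρ x}, ENNReal.ofReal (ρ x * Real.sqrt (∑ i, curl x i ^ 2)))
      ≤ ENNReal.ofReal (∑ j, lam j * ∫ x, ∑ i, ‖pderivC3 (φ j) x i‖ ^ 2) := by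
  have hpt : ∀ x, 0 < ρ x →
      (∑ i, pderivR3 ρ x i ^ 2) / (4 * ρ x) + (∑ i, jp x i ^ 2) / ρ x
        + 1 / Real.sqrt 6 * (ρ x * Real.sqrt (∑ i, curl x i ^ 2))
        ≤ ∑ j, lam j * ∑ i, ‖pderivC3 (φ j) x i‖ ^ 2 := by
    intro x hx
    have hρ' : ρ = fun y => ‖weightedOrbitals lam φ y‖ ^ 2 := by
      simp only [hρ, norm_sq_weightedOrbitals hlam]
    have hx0 : weightedOrbitals lam φ x ≠ 0 := by
      intro h
      simp [hρ', h] at hx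
    refine (kinetic_energy_density_ge (contDiff_weightedOrbitals lam hφ) x hx0 ρ hρ' jp ?_
      (curl x) (by rw [hcurl])).trans_eq ?_
    · simp only [hjp, inner_weightedOrbitals_fderiv hlam hφ]
    · simp only [norm_sq_fderiv_weightedOrbitals hlam hφ, Finset.mul_sum]
      exact Finset.sum_comm
  have hρc : Continuous ρ := by
    rw [hρ]
    exact continuous_finsetSum _ fun j _ =>
      continuous_const.mul ((hφ j).continuous.norm.pow 2)
  have hmeas : MeasurableSet {x | 0 < ρ x} := (isOpen_lt continuous_const hρc).measurableSet
  have hint : ∀ j, Integrable fun x => lam j * ∑ i, ‖pderivC3 (φ j) x i‖ ^ 2 :=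
    fun j => (integrable_sum_norm_sq_pderivC3 (hφ j) (hsupp j)).const_mul _
  have hnonneg : ∀ x, 0 ≤ ∑ j, lam j * ∑ i, ‖pderivC3 (φ j) x i‖ ^ 2 := fun x =>
    Finset.sum_nonneg fun j _ => mul_nonneg (hlam j) (by positivity)
  have hrhs : ∑ j, lam j * ∫ x, ∑ i, ‖pderivC3 (φ j) x i‖ ^ 2
      = ∫ x, ∑ j, lam j * ∑ i, ‖pderivC3 (φ j) x i‖ ^ 2 := by
    rw [integral_finsetSum _ fun j _ => hint j]
    simp only [integral_const_mul]
  rw [hrhs, ofReal_integral_eq_lintegral_ofReal (integrable_finsetSum _ fun j _ => hint j)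
    (Filter.Eventually.of_forall hnonneg)]
  refine (add_le_add (le_lintegral_add _ _) (lintegral_const_mul_le _ _)).trans ?_
  refine (le_lintegral_add _ _).trans ?_
  refine le_trans (setLIntegral_mono' hmeas fun x hx => ?_) (setLIntegral_le_lintegral _ _)
  have hx' : 0 < ρ x := hx
  rw [← ENNReal.ofReal_add (by positivity) (by positivity),
    ← ENNReal.ofReal_mul (by positivity), ← ENNReal.ofReal_add (by positivity) (by positivity)]
  exact ENNReal.ofReal_le_ofReal (hpt x hx')
end

section
/- Let Ω ⊂ ℝ³ be a bounded measurable set with |Ω| > 0, let η : ℝ³ → [0,∞) be integrable with compact support, ∫_{ℝ³} η = 1 and ∫_{ℝ³} y η(y) dy = 0, and let ν₀ ∈ ℝ³ and ℓ > 0. Then (1/|ℓΩ|) ∫_{ℝ³} (1_{ℓΩ} * η)(x) |ν₀ × x|² dx = ℓ² · (1/|Ω|) ∫_Ω |ν₀ × w|² dw + ∫_{ℝ³} η(y) |ν₀ × y|² dy, where ℓΩ = {ℓw : w ∈ Ω} and × is the cross product in ℝ³. In particular, for fixed Ω, η, ν₀ ≠ 0, this quantity grows like ℓ² as ℓ → ∞.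 -/
open MeasureTheory Pointwise

section ConvolutionIntegrand

variable {ι : Type*} [Fintype ι]

lemma integrable_comp_sub_mul {F H : (ι → ℝ) → ℝ} (hF : Integrable F) (hH : Integrable H) :
    Integrable (fun p : (ι → ℝ) × (ι → ℝ) => F (p.1 - p.2) * H p.2) (volume.prod volume) := by
  simpa [mul_comm] using hH.convolution_integrand (ContinuousLinearMap.mul ℝ ℝ) hF

lemma integral_comp_sub_mul {F H : (ι → ℝ) → ℝ} (hF : Integrable F) (hH : Integrable H) :
    ∫ p : (ι → ℝ) × (ι → ℝ), F (p.1 - p.2) * H p.2 ∂(volume.prod volume)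
      = (∫ x, F x) * ∫ y, H y := by
  rw [integral_prod _ (integrable_comp_sub_mul hF hH)]
  simpa [MeasureTheory.convolution, mul_comm] using
    integral_convolution (ContinuousLinearMap.mul ℝ ℝ) hH hF

end ConvolutionIntegrand

lemma integrable_mul_continuous_of_hasCompactSupport {X : Type*} [TopologicalSpace X] [T2Space X]
    [MeasurableSpace X] [OpensMeasurableSpace X] {μ : Measure X} {f g : X → ℝ}
    (hf : Integrable f μ) (hsupp : HasCompactSupport f) (hg : Continuous g) :
    Integrable (fun x => f x * g x) μ := by
  have h := hf.integrableOn.mul_continuousOn hg.continuousOn hsupp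
  rwa [integrableOn_iff_integrable_of_support_subset] at h
  exact (Function.support_mul_subset_left f g).trans (subset_tsupport f)

lemma Bornology.IsBounded.hasCompactSupport_indicator_one {E : Type*} [PseudoMetricSpace E]
    [ProperSpace E] {A : Set E} (hA : Bornology.IsBounded A) :
    HasCompactSupport (A.indicator fun _ => (1 : ℝ)) :=
  hA.isCompact_closure.of_isClosed_subset (isClosed_tsupport _)
    (closure_mono Set.support_indicator_subset)

lemma continuous_crossProduct_apply (ν : Fin 3 → ℝ) (i : Fin 3) :
    Continuous fun x => (crossProduct ν x) i := by
  fin_cases i <;> simp [cross_apply] <;> fun_prop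

lemma integral_mul_crossProduct_eq_zero {η : (Fin 3 → ℝ) → ℝ} (hη : Integrable η)
    (hηsupp : HasCompactSupport η) (hbary : ∀ i, (∫ y : Fin 3 → ℝ, y i * η y) = 0)
    (ν : Fin 3 → ℝ) (i : Fin 3) : ∫ y, η y * (crossProduct ν y) i = 0 := by
  have hint (j : Fin 3) : Integrable fun y : Fin 3 → ℝ => y j * η y := by
    simpa only [mul_comm] using
      integrable_mul_continuous_of_hasCompactSupport hη hηsupp (continuous_apply j)
  have key (a b : ℝ) (j k : Fin 3) : ∫ y : Fin 3 → ℝ, η y * (a * y j - b * y k) = 0 := by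
    calc ∫ y : Fin 3 → ℝ, η y * (a * y j - b * y k)
        = ∫ y : Fin 3 → ℝ, (a * (y j * η y) - b * (y k * η y)) := by
          congr with y; ring
      _ = 0 := by
          rw [integral_sub ((hint j).const_mul a) ((hint k).const_mul b),
            integral_const_mul, integral_const_mul, hbary, hbary]
          simp
  fin_cases i <;> simpa [cross_apply] using key _ _ _ _

/-- Steiner-type identity: the second moment of `ν × x` against `1_A * η` splits when `η` is a
centred probability density. -/
lemma integral_indicator_convolution_mul_crossProduct_sq {A : Set (Fin 3 → ℝ)}
    (hA : MeasurableSet A) (hAbdd : Bornology.IsBounded A)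
    {η : (Fin 3 → ℝ) → ℝ} (hη : Integrable η) (hηsupp : HasCompactSupport η)
    (hηint : (∫ y, η y) = 1) (hηbary : ∀ i, (∫ y : Fin 3 → ℝ, y i * η y) = 0)
    (ν : Fin 3 → ℝ) :
    ∫ x : Fin 3 → ℝ, (∫ y, A.indicator (fun _ => (1 : ℝ)) (x - y) * η y) *
        ∑ i, (crossProduct ν x) i ^ 2
      = (∫ w in A, ∑ i, (crossProduct ν w) i ^ 2)
        + (volume A).toReal * ∫ y, η y * ∑ i, (crossProduct ν y) i ^ 2 := by
  set q : (Fin 3 → ℝ) → ℝ := fun x => ∑ i, (crossProduct ν x) i ^ 2 with hq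
  set f : (Fin 3 → ℝ) → ℝ := A.indicator fun _ => (1 : ℝ) with hf
  have hc := continuous_crossProduct_apply ν
  have hqc : Continuous q := continuous_finsetSum _ fun i _ => (hc i).pow 2
  have hfint : Integrable f :=
    (integrable_indicator_iff hA).2 (integrableOn_const hAbdd.measure_lt_top.ne)
  have hfg {g : (Fin 3 → ℝ) → ℝ} (hg : Continuous g) : Integrable fun x => f x * g x :=
    integrable_mul_continuous_of_hasCompactSupport hfint
      hAbdd.hasCompactSupport_indicator_one hg
  have hηg {g : (Fin 3 → ℝ) → ℝ} (hg : Continuous g) : Integrable fun x => η x * g x :=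
    integrable_mul_continuous_of_hasCompactSupport hη hηsupp hg
  have hI1 := integrable_comp_sub_mul (hfg hqc) hη
  have hI2 (i : Fin 3) := (integrable_comp_sub_mul (hfg (hc i)) (hηg (hc i))).const_mul 2
  have hI2' := integrable_finsetSum Finset.univ fun i _ => hI2 i
  have hI3 := integrable_comp_sub_mul hfint (hηg hqc)
  have hexp (p : (Fin 3 → ℝ) × (Fin 3 → ℝ)) : f (p.1 - p.2) * η p.2 * q p.1
      = f (p.1 - p.2) * q (p.1 - p.2) * η p.2
        + ∑ i, 2 * (f (p.1 - p.2) * (crossProduct ν (p.1 - p.2)) i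
            * (η p.2 * (crossProduct ν p.2) i))
        + f (p.1 - p.2) * (η p.2 * q p.2) := by
    simp only [hq, map_sub, Pi.sub_apply, Fin.sum_univ_three]
    ring
  have hI : Integrable (fun p : (Fin 3 → ℝ) × (Fin 3 → ℝ) => f (p.1 - p.2) * η p.2 * q p.1)
      (volume.prod volume) := by
    simp_rw [hexp]
    exact (hI1.add hI2').add hI3
  have hfq : ∫ x, f x * q x = ∫ x in A, q x := by
    rw [← integral_indicator hA]
    congr with x
    by_cases hx : x ∈ A <;> simp [hf, hx]
  have hf1 : ∫ x, f x = (volume A).toReal := by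
    simp [hf, integral_indicator hA, Measure.real]
  calc ∫ x, (∫ y, f (x - y) * η y) * q x
      = ∫ p : (Fin 3 → ℝ) × (Fin 3 → ℝ), f (p.1 - p.2) * η p.2 * q p.1
          ∂(volume.prod volume) := by
        rw [integral_prod _ hI]
        simp_rw [integral_mul_const]
    _ = _ := by
        simp_rw [hexp]
        rw [integral_add (hI1.fun_add hI2') hI3, integral_add hI1 hI2',
          integral_finsetSum _ fun i _ => hI2 i]
        simp_rw [integral_const_mul]
        rw [integral_comp_sub_mul (hfg hqc) hη, integral_comp_sub_mul hfint (hηg hqc)]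
        simp_rw [fun i => integral_comp_sub_mul (hfg (hc i)) (hηg (hc i)),
          integral_mul_crossProduct_eq_zero hη hηsupp hηbary ν]
        rw [hηint, hfq, hf1]
        simp [hq]

theorem stmt16 (Ω : Set (Fin 3 → ℝ)) (hΩ : MeasurableSet Ω)
    (hΩbdd : Bornology.IsBounded Ω) (hΩpos : 0 < volume Ω)
    (η : (Fin 3 → ℝ) → ℝ) (hη : Integrable η) (hηnn : ∀ y, 0 ≤ η y)
    (hηsupp : HasCompactSupport η) (hηint : (∫ y, η y) = 1)
    (hηbary : ∀ i, (∫ y : Fin 3 → ℝ, y i * η y) = 0)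
    (ν₀ : Fin 3 → ℝ) (ℓ : ℝ) (hℓ : 0 < ℓ) :
    (1 / (volume (ℓ • Ω)).toReal) *
        ∫ x : Fin 3 → ℝ,
          (∫ y, (ℓ • Ω).indicator (fun _ => (1 : ℝ)) (x - y) * η y) *
            ∑ i, (crossProduct ν₀ x) i ^ 2
      = ℓ ^ 2 * ((1 / (volume Ω).toReal) * ∫ w in Ω, ∑ i, (crossProduct ν₀ w) i ^ 2)
        + ∫ y, η y * ∑ i, (crossProduct ν₀ y) i ^ 2 := by
  have hvol : (volume (ℓ • Ω)).toReal = ℓ ^ 3 * (volume Ω).toReal := by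
    simp [Measure.addHaar_smul, abs_of_pos hℓ, ENNReal.toReal_ofReal (pow_nonneg hℓ.le 3)]
  have hV : (volume Ω).toReal ≠ 0 :=
    (ENNReal.toReal_pos hΩpos.ne' hΩbdd.measure_lt_top.ne).ne'
  have hscale := Measure.setIntegral_comp_smul_of_pos volume
    (fun x : Fin 3 → ℝ => ∑ i, (crossProduct ν₀ x) i ^ 2) Ω hℓ
  simp only [map_smul, Pi.smul_apply, smul_eq_mul, mul_pow, ← Finset.mul_sum,
    integral_const_mul, Module.finrank_fin_fun] at hscale
  rw [integral_indicator_convolution_mul_crossProduct_sq (hΩ.const_smul₀ ℓ) (hΩbdd.smul₀ ℓ)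
    hη hηsupp hηint hηbary ν₀, hvol]
  have hℓ0 := hℓ.ne'
  field_simp at hscale ⊢
  linear_combination -hscale
end
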